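/- arXiv:1709.07778 — 2 statements merged into one kernel-verified Lean document; each statement's English description precedes it below -/
import Mathlib

section
/- Let U ~ N(μ_U, σ_U²) and V ~ N(μ_V, σ_V²) be real Gaussian random variables with μ_U ≥ μ_V and 0 < σ_U ≤ σ_V. Let H : ℝ → ℝ be differentiable, nondecreasing, with nonincreasing derivative H′ (so H is concave and increasing), and assume E|H(W)| < ∞ for every Gaussian W with mean in [μ_V, μ_U] and standard deviation in [σ_U, σ_V]. Then E[H(U)] ≥ E[H(V)]. -/
open MeasureTheory Real Set

noncomputable section

/-- Standard normal probability density function. -/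
def stdPdf (z : ℝ) : ℝ := (Real.sqrt (2 * Real.pi))⁻¹ * Real.exp (-z ^ 2 / 2)

/-- The standard normal density is even. -/
lemma stdPdf_neg (z : ℝ) : stdPdf (-z) = stdPdf z := by
  simp [stdPdf]

lemma stdPdf_nonneg (z : ℝ) : 0 ≤ stdPdf z := by
  unfold stdPdf
  positivity

lemma gaussian_density_comp_affine (H : ℝ → ℝ) (μ : ℝ) {σ : ℝ} (hσ : σ ≠ 0) (z : ℝ) :
    σ * (H (μ + σ * z) * (σ⁻¹ * stdPdf ((μ + σ * z - μ) / σ))) = H (μ + σ * z) * stdPdf z := by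
  have h : (μ + σ * z - μ) / σ = z := by
    field_simp
    ring
  rw [h]
  field_simp

/-- Standardization: an expectation under `N(μ, σ²)` as an expectation under `N(0, 1)`. -/
lemma integral_gaussian_density_eq (H : ℝ → ℝ) (μ : ℝ) {σ : ℝ} (hσ : 0 < σ) :
    ∫ u : ℝ, H u * (σ⁻¹ * stdPdf ((u - μ) / σ)) = ∫ z : ℝ, H (μ + σ * z) * stdPdf z := by
  simp_rw [← gaussian_density_comp_affine H μ hσ.ne', integral_const_mul]
  rw [Measure.integral_comp_mul_left
      (fun y => H (μ + y) * (σ⁻¹ * stdPdf ((μ + y - μ) / σ))) σ,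
    integral_add_left_eq_self (fun u => H u * (σ⁻¹ * stdPdf ((u - μ) / σ))) μ,
    abs_of_pos (inv_pos.2 hσ), smul_eq_mul, mul_inv_cancel_left₀ hσ.ne']

lemma integrable_comp_affine_mul_stdPdf {H : ℝ → ℝ} {μ σ : ℝ} (hσ : σ ≠ 0)
    (h : Integrable fun u : ℝ => H u * (σ⁻¹ * stdPdf ((u - μ) / σ))) :
    Integrable fun z : ℝ => H (μ + σ * z) * stdPdf z := by
  simp_rw [← gaussian_density_comp_affine H μ hσ]
  exact ((h.comp_add_left μ).comp_mul_left' hσ).const_mul σ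

/-- Symmetric spreading decreases the sum of the values of a concave function. -/
lemma ConcaveOn.add_le_add_of_symmetric_spread {H : ℝ → ℝ} (hH : ConcaveOn ℝ univ H) {a b : ℝ}
    (ha : 0 < a) (hab : a ≤ b) (μ z : ℝ) :
    H (μ + b * z) + H (μ + b * -z) ≤ H (μ + a * z) + H (μ + a * -z) := by
  have hb : 0 < b := ha.trans_le hab
  have ht₀ : 0 < a / b := div_pos ha hb
  have ht₁ : a / b ≤ 1 := (div_le_one hb).2 hab
  have htb : a / b * b = a := div_mul_cancel₀ a hb.ne'
  set t := a / b
  have key (w : ℝ) :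
      (1 + t) / 2 * H (μ + b * w) + (1 - t) / 2 * H (μ + b * -w) ≤ H (μ + a * w) := by
    have h := hH.2 (mem_univ (μ + b * w)) (mem_univ (μ + b * -w))
      (by linarith : 0 ≤ (1 + t) / 2) (by linarith : 0 ≤ (1 - t) / 2) (by ring)
    simp only [smul_eq_mul] at h
    have hw : (1 + t) / 2 * (μ + b * w) + (1 - t) / 2 * (μ + b * -w) = μ + a * w := by
      rw [← htb]
      ring
    rwa [hw] at h
  have h₁ := key z
  have h₂ := key (-z)
  rw [neg_neg] at h₂
  linarith

/-- The expectation of a concave function of a Gaussian decreases with the standard deviation. -/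
lemma ConcaveOn.integral_comp_affine_mul_stdPdf_le {H : ℝ → ℝ} (hH : ConcaveOn ℝ univ H)
    {μ a b : ℝ} (ha : 0 < a) (hab : a ≤ b)
    (hia : Integrable fun z : ℝ => H (μ + a * z) * stdPdf z)
    (hib : Integrable fun z : ℝ => H (μ + b * z) * stdPdf z) :
    ∫ z : ℝ, H (μ + b * z) * stdPdf z ≤ ∫ z : ℝ, H (μ + a * z) * stdPdf z := by
  have reflect (c : ℝ) : ∫ z : ℝ, H (μ + c * -z) * stdPdf (-z) =
      ∫ z : ℝ, H (μ + c * z) * stdPdf z :=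
    integral_neg_eq_self (fun z => H (μ + c * z) * stdPdf z) volume
  have h : ∫ z : ℝ, (H (μ + b * z) * stdPdf z + H (μ + b * -z) * stdPdf (-z)) ≤
      ∫ z : ℝ, (H (μ + a * z) * stdPdf z + H (μ + a * -z) * stdPdf (-z)) := by
    refine integral_mono (hib.add hib.comp_neg) (hia.add hia.comp_neg) fun z => ?_
    simp only [stdPdf_neg, ← add_mul]
    exact mul_le_mul_of_nonneg_right (hH.add_le_add_of_symmetric_spread ha hab μ z)
      (stdPdf_nonneg z)
  rw [integral_add hib hib.comp_neg, integral_add hia hia.comp_neg, reflect, reflect] at h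
  linarith

/-- If `U ~ N(μ_U, σ_U²)`, `V ~ N(μ_V, σ_V²)` with `μ_U ≥ μ_V`, `0 < σ_U ≤ σ_V`, and
`H` is differentiable, nondecreasing, with nonincreasing derivative, then
`E H(U) ≥ E H(V)` (expectations assumed finite for all intermediate Gaussians). -/
theorem stmt15 (μU μV σU σV : ℝ) (hμ : μV ≤ μU) (hσU : 0 < σU) (hσ : σU ≤ σV)
    (H : ℝ → ℝ) (hdiff : Differentiable ℝ H) (hmono : Monotone H)
    (hderiv : Antitone (deriv H))
    (hint : ∀ μ ∈ Set.Icc μV μU, ∀ σ ∈ Set.Icc σU σV,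
      Integrable (fun u : ℝ => H u * (σ⁻¹ * stdPdf ((u - μ) / σ)))) :
    (∫ u : ℝ, H u * (σV⁻¹ * stdPdf ((u - μV) / σV))) ≤
      ∫ u : ℝ, H u * (σU⁻¹ * stdPdf ((u - μU) / σU)) := by
  have hσV : 0 < σV := hσU.trans_le hσ
  have hconc : ConcaveOn ℝ univ H := Antitone.concaveOn_univ_of_deriv hdiff hderiv
  have hVV := integrable_comp_affine_mul_stdPdf hσV.ne'
    (hint μV ⟨le_rfl, hμ⟩ σV ⟨hσ, le_rfl⟩)
  have hUV := integrable_comp_affine_mul_stdPdf hσV.ne'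
    (hint μU ⟨hμ, le_rfl⟩ σV ⟨hσ, le_rfl⟩)
  have hUU := integrable_comp_affine_mul_stdPdf hσU.ne'
    (hint μU ⟨hμ, le_rfl⟩ σU ⟨le_rfl, hσ⟩)
  rw [integral_gaussian_density_eq H μV hσV, integral_gaussian_density_eq H μU hσU]
  calc ∫ z : ℝ, H (μV + σV * z) * stdPdf z
      ≤ ∫ z : ℝ, H (μU + σV * z) * stdPdf z :=
        integral_mono hVV hUV fun z =>
          mul_le_mul_of_nonneg_right (hmono (by linarith)) (stdPdf_nonneg z)
    _ ≤ ∫ z : ℝ, H (μU + σU * z) * stdPdf z :=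
        hconc.integral_comp_affine_mul_stdPdf_le hσU hσ hUU hUV

end
end

section
/- Let p = 1 and A = [0, ∞), i.e., the constraint is θ1 ≥ θ2. Define τ = √(σ1² + σ_Y²), β = σ1²/(σ1² + σ_Y²), σ_T² = σ2² + βσ_Y². Let q̂_mre(y; x) = (1/τ)φ((y − x1)/τ) be the minimum risk equivariant predictive density, and let q̂_B(y; x) = (1/τ)φ((y − x1)/τ) · Φ( (β(y − x1) + (x1 − x2))/σ_T ) / Φ( (x1 − x2)/√(σ1² + σ2²) ) be the Bayes predictive density under the uniform prior 1_{[0,∞)}(θ1 − θ2). Then for every (θ1, θ2) with θ1 ≥ θ2, R_KL(θ, q̂_B) ≤ R_KL(θ, q̂_mre), with equality if and only if θ1 = θ2; i.e., q̂_B dominates q̂_mre under Kullback–Leibler risk on the restricted parameter space. -/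
open MeasureTheory Real Set

noncomputable section

/-- Standard normal cumulative distribution function. -/
def stdCdf (x : ℝ) : ℝ := ∫ t in Set.Iic x, stdPdf t

/-- Density of `N(θ, σ²)` (σ the standard deviation) at `y`. -/
def gd (σ : ℝ) (u : ℝ) : ℝ := σ⁻¹ * stdPdf (u / σ)

/-- Kullback–Leibler risk in the univariate model `X1 ~ N(θ1,σ1²)`, `X2 ~ N(θ2,σ2²)`,
`Y1 ~ N(θ1,σY²)` (σ's are standard deviations). -/
def klRisk1 (σ1 σ2 σY : ℝ) (θ1 θ2 : ℝ) (qhat : ℝ × ℝ → ℝ → ℝ) : ℝ :=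
  ∫ x : ℝ × ℝ,
    (∫ y : ℝ, gd σY (y - θ1) * Real.log (gd σY (y - θ1) / qhat x y)) *
      (gd σ1 (x.1 - θ1) * gd σ2 (x.2 - θ2))

open ProbabilityTheory

lemma stdPdf_eq_gaussianPDFReal : stdPdf = gaussianPDFReal 0 1 := by
  ext z
  simp [stdPdf, gaussianPDFReal]

lemma stdPdf_pos (z : ℝ) : 0 < stdPdf z := by
  rw [stdPdf_eq_gaussianPDFReal]
  exact gaussianPDFReal_pos 0 1 z one_ne_zero

lemma integrable_stdPdf : Integrable stdPdf := by
  rw [stdPdf_eq_gaussianPDFReal]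
  exact integrable_gaussianPDFReal 0 1

lemma gd_eq_gaussianPDFReal {σ : ℝ} (hσ : 0 < σ) (θ y : ℝ) :
    gd σ (y - θ) = gaussianPDFReal θ (σ ^ 2).toNNReal y := by
  rw [gd, stdPdf, gaussianPDFReal, Real.coe_toNNReal _ (sq_nonneg σ),
    Real.sqrt_mul (by positivity : 0 ≤ 2 * π), Real.sqrt_sq hσ.le, mul_inv, ← mul_assoc, mul_comm σ⁻¹]
  congr 2
  field_simp

lemma stdCdf_sub_stdCdf (a b : ℝ) : stdCdf b - stdCdf a = ∫ t in a..b, stdPdf t :=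
  intervalIntegral.integral_Iic_sub_Iic integrable_stdPdf.integrableOn
    integrable_stdPdf.integrableOn

lemma stdCdf_nonneg (x : ℝ) : 0 ≤ stdCdf x :=
  integral_nonneg fun t => (stdPdf_pos t).le

lemma strictMono_stdCdf : StrictMono stdCdf := fun a b hab => by
  rw [← sub_pos, stdCdf_sub_stdCdf]
  exact intervalIntegral.intervalIntegral_pos_of_pos integrable_stdPdf.intervalIntegrable
    stdPdf_pos hab

lemma stdCdf_pos (x : ℝ) : 0 < stdCdf x :=
  (stdCdf_nonneg (x - 1)).trans_lt (strictMono_stdCdf (sub_one_lt x))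

lemma stdCdf_le_one (x : ℝ) : stdCdf x ≤ 1 := by
  have h : ∫ t, stdPdf t = 1 := by
    rw [stdPdf_eq_gaussianPDFReal]
    exact integral_gaussianPDFReal_eq_one 0 one_ne_zero
  rw [← h]
  exact setIntegral_le_integral integrable_stdPdf (ae_of_all _ fun t => (stdPdf_pos t).le)

lemma stdPdf_le_stdCdf (x : ℝ) : stdPdf (|x| + 1) ≤ stdCdf x := by
  have h : ∫ _ in (x - 1)..x, stdPdf (|x| + 1) ≤ ∫ t in (x - 1)..x, stdPdf t := by
    refine intervalIntegral.integral_mono_on (by linarith) (by simp)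
      integrable_stdPdf.intervalIntegrable fun t ht => ?_
    have habs : |t| ≤ |x| + 1 :=
      abs_le.2 ⟨by linarith [ht.1, neg_abs_le x], by linarith [ht.2, le_abs_self x]⟩
    have hsq : t ^ 2 ≤ (|x| + 1) ^ 2 := sq_le_sq' (by linarith [neg_abs_le t]) (by
      linarith [le_abs_self t])
    unfold stdPdf
    gcongr
  rw [← stdCdf_sub_stdCdf] at h
  simp only [intervalIntegral.integral_const, sub_sub_cancel, one_smul] at h
  linarith [stdCdf_nonneg (x - 1)]

lemma log_stdPdf (z : ℝ) : Real.log (stdPdf z) = -Real.log (Real.sqrt (2 * π)) - z ^ 2 / 2 := by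
  rw [stdPdf, Real.log_mul (by positivity) (by positivity), Real.log_inv, Real.log_exp]
  ring

lemma measurable_log_stdCdf : Measurable fun x => Real.log (stdCdf x) :=
  Real.measurable_log.comp strictMono_stdCdf.monotone.measurable

lemma integrable_sq_gaussianReal (m : ℝ) (v : NNReal) :
    Integrable (fun x => x ^ 2) (gaussianReal m v) :=
  (memLp_id_gaussianReal' 2 (by simp)).integrable_sq

lemma integrable_log_stdCdf_gaussianReal (m : ℝ) (v : NNReal) :
    Integrable (fun x => Real.log (stdCdf x)) (gaussianReal m v) := by
  refine Integrable.mono' (((integrable_const |Real.log (Real.sqrt (2 * π))|).add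
    (integrable_sq_gaussianReal m v)).add (integrable_const 1))
    measurable_log_stdCdf.aestronglyMeasurable (ae_of_all _ fun x => ?_)
  have hlow := Real.log_le_log (stdPdf_pos _) (stdPdf_le_stdCdf x)
  rw [log_stdPdf] at hlow
  have hup := Real.log_nonpos (stdCdf_nonneg x) (stdCdf_le_one x)
  simp only [Real.norm_eq_abs, abs_of_nonpos hup, Pi.add_apply]
  nlinarith [le_abs_self (Real.log (Real.sqrt (2 * π))), sq_abs x, sq_nonneg (|x| - 1)]

/-- The Gaussian mean of `log Φ` is strictly increasing in the location parameter. -/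
lemma strictMono_integral_log_stdCdf :
    StrictMono fun m : ℝ => ∫ x, Real.log (stdCdf x) ∂gaussianReal m 1 := fun a b hab => by
  have hint (m : ℝ) : Integrable (fun x => Real.log (stdCdf (m + x))) (gaussianReal 0 1) := by
    have h := integrable_log_stdCdf_gaussianReal (0 + m) 1
    rw [← gaussianReal_map_const_add] at h
    exact h.comp_measurable (by fun_prop)
  have heq (m : ℝ) : ∫ x, Real.log (stdCdf x) ∂gaussianReal m 1 =
      ∫ x, Real.log (stdCdf (m + x)) ∂gaussianReal 0 1 := by
    have h := gaussianReal_map_const_add (μ := 0) (v := 1) m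
    rw [zero_add] at h
    rw [← h, integral_map (by fun_prop) measurable_log_stdCdf.aestronglyMeasurable]
  have hlt (x : ℝ) : Real.log (stdCdf (a + x)) < Real.log (stdCdf (b + x)) :=
    Real.log_lt_log (stdCdf_pos _) (strictMono_stdCdf (by linarith))
  simp only [heq]
  rw [← sub_pos, ← integral_sub (hint b) (hint a),
    integral_pos_iff_support_of_nonneg (fun x => (sub_pos.2 (hlt x)).le) ((hint b).sub (hint a))]
  have hsupp : Function.support (fun x => Real.log (stdCdf (b + x)) -
      Real.log (stdCdf (a + x))) = univ := by
    ext x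
    simpa using (sub_pos.2 (hlt x)).ne'
  rw [hsupp]
  simp

/-- Joint law of `((X₁, X₂), Y₁)`. -/
def jointLaw (σ1 σ2 σY θ1 θ2 : ℝ) : Measure ((ℝ × ℝ) × ℝ) :=
  ((gaussianReal θ1 (σ1 ^ 2).toNNReal).prod (gaussianReal θ2 (σ2 ^ 2).toNNReal)).prod
    (gaussianReal θ1 (σY ^ 2).toNNReal)

instance (σ1 σ2 σY θ1 θ2 : ℝ) : IsProbabilityMeasure (jointLaw σ1 σ2 σY θ1 θ2) := by
  unfold jointLaw
  infer_instance

lemma map_linear_jointLaw (σ1 σ2 σY θ1 θ2 a b c : ℝ) :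
    (jointLaw σ1 σ2 σY θ1 θ2).map (fun p => a * p.1.1 + b * p.1.2 + c * p.2) =
      gaussianReal (a * θ1 + b * θ2 + c * θ1)
        (a ^ 2 * σ1 ^ 2 + b ^ 2 * σ2 ^ 2 + c ^ 2 * σY ^ 2).toNNReal := by
  have hv : (a ^ 2 * σ1 ^ 2 + b ^ 2 * σ2 ^ 2 + c ^ 2 * σY ^ 2).toNNReal =
      NNReal.mk (a ^ 2) (sq_nonneg a) * (σ1 ^ 2).toNNReal +
        NNReal.mk (b ^ 2) (sq_nonneg b) * (σ2 ^ 2).toNNReal +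
        NNReal.mk (c ^ 2) (sq_nonneg c) * (σY ^ 2).toNNReal := by
    ext
    simp only [NNReal.coe_add, NNReal.coe_mul, NNReal.coe_mk]
    rw [Real.coe_toNNReal _ (by positivity), Real.coe_toNNReal _ (by positivity),
      Real.coe_toNNReal _ (by positivity), Real.coe_toNNReal _ (by positivity)]
  rw [hv, ← gaussianReal_conv_gaussianReal, ← gaussianReal_conv_gaussianReal,
    ← gaussianReal_map_const_mul, ← gaussianReal_map_const_mul, ← gaussianReal_map_const_mul]
  unfold jointLaw Measure.conv
  rw [Measure.map_prod_map (gaussianReal θ1 _) (gaussianReal θ2 _) (by fun_prop) (by fun_prop),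
    Measure.map_map (by fun_prop) (by fun_prop),
    Measure.map_prod_map _ _ (by fun_prop) (by fun_prop),
    Measure.map_map (by fun_prop) (by fun_prop)]
  rfl

lemma integrable_comp_linear_jointLaw {σ1 σ2 σY θ1 θ2 : ℝ} {f : ℝ → ℝ}
    (hf : ∀ m v, Integrable f (gaussianReal m v)) (a b c : ℝ) :
    Integrable (fun p => f (a * p.1.1 + b * p.1.2 + c * p.2)) (jointLaw σ1 σ2 σY θ1 θ2) := by
  have h := hf (a * θ1 + b * θ2 + c * θ1)
    (a ^ 2 * σ1 ^ 2 + b ^ 2 * σ2 ^ 2 + c ^ 2 * σY ^ 2).toNNReal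
  rw [← map_linear_jointLaw] at h
  exact h.comp_measurable (by fun_prop)

lemma integral_comp_linear_jointLaw {σ1 σ2 σY θ1 θ2 : ℝ} {f : ℝ → ℝ} (hf : Measurable f)
    {a b c : ℝ} (hvar : a ^ 2 * σ1 ^ 2 + b ^ 2 * σ2 ^ 2 + c ^ 2 * σY ^ 2 = 1) :
    ∫ p, f (a * p.1.1 + b * p.1.2 + c * p.2) ∂jointLaw σ1 σ2 σY θ1 θ2 =
      ∫ x, f x ∂gaussianReal (a * θ1 + b * θ2 + c * θ1) 1 := by
  have h := map_linear_jointLaw σ1 σ2 σY θ1 θ2 a b c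
  rw [hvar, Real.toNNReal_one] at h
  rw [← h, integral_map (by fun_prop) hf.aestronglyMeasurable]

/-- Under joint integrability, the Kullback–Leibler risk is an expectation of a log-ratio. -/
lemma klRisk1_eq_integral_jointLaw {σ1 σ2 σY : ℝ} (h1 : 0 < σ1) (h2 : 0 < σ2) (hY : 0 < σY)
    (θ1 θ2 : ℝ) (qhat : ℝ × ℝ → ℝ → ℝ)
    (hint : Integrable (fun p : (ℝ × ℝ) × ℝ => Real.log (gd σY (p.2 - θ1) / qhat p.1 p.2))
      (jointLaw σ1 σ2 σY θ1 θ2)) :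
    klRisk1 σ1 σ2 σY θ1 θ2 qhat =
      ∫ p, Real.log (gd σY (p.2 - θ1) / qhat p.1 p.2) ∂jointLaw σ1 σ2 σY θ1 θ2 := by
  have hv {σ : ℝ} (hσ : 0 < σ) : (σ ^ 2).toNNReal ≠ 0 := (Real.toNNReal_pos.2 (by positivity)).ne'
  unfold jointLaw at hint ⊢
  rw [integral_prod _ hint, gaussianReal_of_var_ne_zero _ (hv h1),
    gaussianReal_of_var_ne_zero _ (hv h2),
    prod_withDensity (measurable_gaussianPDF _ _) (measurable_gaussianPDF _ _),
    integral_withDensity_eq_integral_toReal_smul (by fun_prop)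
      (ae_of_all _ fun _ => ENNReal.mul_lt_top gaussianPDF_lt_top gaussianPDF_lt_top)]
  unfold klRisk1
  refine integral_congr_ae (ae_of_all _ fun x => ?_)
  simp only [ENNReal.toReal_mul, toReal_gaussianPDF, smul_eq_mul,
    integral_gaussianReal_eq_integral_smul (hv hY), gd_eq_gaussianPDFReal h1,
    gd_eq_gaussianPDFReal h2, gd_eq_gaussianPDFReal hY]
  ring

lemma log_gd {σ : ℝ} (hσ : 0 < σ) (u : ℝ) :
    Real.log (gd σ u) = -Real.log σ - Real.log (Real.sqrt (2 * π)) - (u / σ) ^ 2 / 2 := by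
  rw [gd, Real.log_mul (by positivity) (stdPdf_pos _).ne', Real.log_inv, log_stdPdf]
  ring

lemma gd_pos {σ : ℝ} (hσ : 0 < σ) (u : ℝ) : 0 < gd σ u :=
  mul_pos (inv_pos.2 hσ) (stdPdf_pos _)

lemma integrable_log_gd_ratio {σ1 σ2 σY τ : ℝ} (hY : 0 < σY) (hτ : 0 < τ) (θ1 θ2 : ℝ) :
    Integrable (fun p : (ℝ × ℝ) × ℝ => Real.log (gd σY (p.2 - θ1) / gd τ (p.2 - p.1.1)))
      (jointLaw σ1 σ2 σY θ1 θ2) := by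
  have hsq (m : ℝ) (v : NNReal) : Integrable (fun x => (x - θ1 / σY) ^ 2) (gaussianReal m v) :=
    ((memLp_id_gaussianReal' 2 (by simp)).sub (memLp_const (θ1 / σY))).integrable_sq
  have e1 := integrable_comp_linear_jointLaw (σ1 := σ1) (σ2 := σ2) (σY := σY) (θ1 := θ1)
    (θ2 := θ2) hsq 0 0 σY⁻¹
  have e2 := integrable_comp_linear_jointLaw (σ1 := σ1) (σ2 := σ2) (σY := σY) (θ1 := θ1)
    (θ2 := θ2) integrable_sq_gaussianReal (-τ⁻¹) 0 τ⁻¹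
  refine (((e2.sub e1).div_const 2).add (integrable_const (Real.log τ - Real.log σY))).congr
    (ae_of_all _ fun p => ?_)
  simp only [Pi.add_apply, Pi.sub_apply]
  rw [Real.log_div (gd_pos hY _).ne' (gd_pos hτ _).ne', log_gd hY, log_gd hτ]
  ring

/-- For `p = 1`, `A = [0, ∞)`, the uniform-prior Bayes predictive density dominates the
minimum risk equivariant predictive density under Kullback–Leibler risk on
`{θ1 ≥ θ2}`, with equality of risks iff `θ1 = θ2`. -/
theorem stmt16 (σ1 σ2 σY : ℝ) (h1 : 0 < σ1) (h2 : 0 < σ2) (hY : 0 < σY)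
    (τ β σT : ℝ) (hτ : τ = Real.sqrt (σ1 ^ 2 + σY ^ 2))
    (hβ : β = σ1 ^ 2 / (σ1 ^ 2 + σY ^ 2))
    (hσT : σT = Real.sqrt (σ2 ^ 2 + β * σY ^ 2)) :
    ∀ θ1 θ2 : ℝ, θ2 ≤ θ1 →
      (klRisk1 σ1 σ2 σY θ1 θ2
          (fun x y => τ⁻¹ * stdPdf ((y - x.1) / τ) *
            stdCdf ((β * (y - x.1) + (x.1 - x.2)) / σT) /
            stdCdf ((x.1 - x.2) / Real.sqrt (σ1 ^ 2 + σ2 ^ 2))) ≤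
        klRisk1 σ1 σ2 σY θ1 θ2 (fun x y => τ⁻¹ * stdPdf ((y - x.1) / τ))) ∧
      (klRisk1 σ1 σ2 σY θ1 θ2
          (fun x y => τ⁻¹ * stdPdf ((y - x.1) / τ) *
            stdCdf ((β * (y - x.1) + (x.1 - x.2)) / σT) /
            stdCdf ((x.1 - x.2) / Real.sqrt (σ1 ^ 2 + σ2 ^ 2))) =
        klRisk1 σ1 σ2 σY θ1 θ2 (fun x y => τ⁻¹ * stdPdf ((y - x.1) / τ)) ↔
        θ1 = θ2) := by
  intro θ1 θ2 hθ
  have hτ0 : 0 < τ := by rw [hτ]; positivity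
  have hβ0 : 0 < β := by rw [hβ]; positivity
  have hσT0 : 0 < σT := by rw [hσT]; positivity
  have hσTsq : σT ^ 2 = σ2 ^ 2 + β * σY ^ 2 := by rw [hσT]; exact Real.sq_sqrt (by positivity)
  set s := Real.sqrt (σ1 ^ 2 + σ2 ^ 2) with hs
  have hs0 : 0 < s := by positivity
  have hssq : s ^ 2 = σ1 ^ 2 + σ2 ^ 2 := Real.sq_sqrt (by positivity)
  have hlt : σT < s := by
    refine lt_of_pow_lt_pow_left₀ 2 hs0.le ?_
    have : β * σY ^ 2 < σ1 ^ 2 := by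
      rw [hβ, div_mul_eq_mul_div, div_lt_iff₀ (by positivity)]
      nlinarith [pow_pos h1 4]
    linarith
  have hvarU : ((1 - β) / σT) ^ 2 * σ1 ^ 2 + (-σT⁻¹) ^ 2 * σ2 ^ 2 + (β / σT) ^ 2 * σY ^ 2 = 1 := by
    have key : (1 - β) ^ 2 * σ1 ^ 2 + β ^ 2 * σY ^ 2 = β * σY ^ 2 := by
      rw [hβ]
      field_simp
      ring
    have : (1 - β) ^ 2 * σ1 ^ 2 + σ2 ^ 2 + β ^ 2 * σY ^ 2 = σT ^ 2 := by linarith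
    field_simp
    linarith
  have hvarV : s⁻¹ ^ 2 * σ1 ^ 2 + (-s⁻¹) ^ 2 * σ2 ^ 2 + (0 : ℝ) ^ 2 * σY ^ 2 = 1 := by
    field_simp
    linarith
  have iU := integrable_comp_linear_jointLaw (σ1 := σ1) (σ2 := σ2) (σY := σY) (θ1 := θ1)
    (θ2 := θ2) integrable_log_stdCdf_gaussianReal ((1 - β) / σT) (-σT⁻¹) (β / σT)
  have iV := integrable_comp_linear_jointLaw (σ1 := σ1) (σ2 := σ2) (σY := σY) (θ1 := θ1)
    (θ2 := θ2) integrable_log_stdCdf_gaussianReal s⁻¹ (-s⁻¹) 0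
  have iM := integrable_log_gd_ratio (σ1 := σ1) (σ2 := σ2) hY hτ0 θ1 θ2
  have hlog (p : (ℝ × ℝ) × ℝ) :
      Real.log (gd σY (p.2 - θ1) / (τ⁻¹ * stdPdf ((p.2 - p.1.1) / τ) *
        stdCdf ((β * (p.2 - p.1.1) + (p.1.1 - p.1.2)) / σT) / stdCdf ((p.1.1 - p.1.2) / s))) =
      Real.log (gd σY (p.2 - θ1) / gd τ (p.2 - p.1.1)) -
        (Real.log (stdCdf ((1 - β) / σT * p.1.1 + -σT⁻¹ * p.1.2 + β / σT * p.2)) -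
          Real.log (stdCdf (s⁻¹ * p.1.1 + -s⁻¹ * p.1.2 + 0 * p.2))) := by
    have eU : (β * (p.2 - p.1.1) + (p.1.1 - p.1.2)) / σT =
        (1 - β) / σT * p.1.1 + -σT⁻¹ * p.1.2 + β / σT * p.2 := by ring
    have eV : (p.1.1 - p.1.2) / s = s⁻¹ * p.1.1 + -s⁻¹ * p.1.2 + 0 * p.2 := by ring
    rw [eU, eV, ← gd]
    have hg := (gd_pos hτ0 (p.2 - p.1.1)).ne'
    rw [Real.log_div (gd_pos hY _).ne'
        (div_ne_zero (mul_ne_zero hg (stdCdf_pos _).ne') (stdCdf_pos _).ne'),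
      Real.log_div (mul_ne_zero hg (stdCdf_pos _).ne') (stdCdf_pos _).ne',
      Real.log_mul hg (stdCdf_pos _).ne', Real.log_div (gd_pos hY _).ne' hg]
    ring
  have hB := klRisk1_eq_integral_jointLaw h1 h2 hY θ1 θ2
    (fun x y => τ⁻¹ * stdPdf ((y - x.1) / τ) *
      stdCdf ((β * (y - x.1) + (x.1 - x.2)) / σT) / stdCdf ((x.1 - x.2) / s))
    ((iM.sub (iU.sub iV)).congr (ae_of_all _ fun p => (hlog p).symm))
  have hM := klRisk1_eq_integral_jointLaw h1 h2 hY θ1 θ2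
    (fun x y => τ⁻¹ * stdPdf ((y - x.1) / τ)) iM
  simp only [hlog] at hB
  replace hB := hB.trans (integral_sub iM (iU.sub iV))
  rw [integral_sub iU iV,
    integral_comp_linear_jointLaw measurable_log_stdCdf hvarU,
    integral_comp_linear_jointLaw measurable_log_stdCdf hvarV] at hB
  have mU : (1 - β) / σT * θ1 + -σT⁻¹ * θ2 + β / σT * θ1 = (θ1 - θ2) / σT := by ring
  have mV : s⁻¹ * θ1 + -s⁻¹ * θ2 + 0 * θ1 = (θ1 - θ2) / s := by ring
  rw [mU, mV] at hB
  have hM' : klRisk1 σ1 σ2 σY θ1 θ2 (fun x y => τ⁻¹ * stdPdf ((y - x.1) / τ)) =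
      ∫ p, Real.log (gd σY (p.2 - θ1) / gd τ (p.2 - p.1.1)) ∂jointLaw σ1 σ2 σY θ1 θ2 := hM
  rw [hB, hM', sub_le_self_iff, sub_nonneg, sub_eq_self, sub_eq_zero]
  refine ⟨strictMono_integral_log_stdCdf.monotone
    (div_le_div_of_nonneg_left (sub_nonneg.2 hθ) hσT0 hlt.le), fun h => ?_, fun h => by simp [h]⟩
  have hmean := strictMono_integral_log_stdCdf.injective h
  by_contra hne
  have hpos : 0 < θ1 - θ2 := sub_pos.2 (lt_of_le_of_ne hθ (Ne.symm hne))
  exact (div_lt_div_of_pos_left hpos hσT0 hlt).ne' hmean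

end
end
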